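/- arXiv:1011.5270 — 2 statements merged into one kernel-verified Lean document; each statement's English description precedes it below -/
import Mathlib

section
/- Let H be an assignment taking every finite metric space (X,d) to a persistent set (X, θ_X^H) on the same underlying set, such that: (functoriality) for every distance non-increasing map f : (X,d_X) → (Y,d_Y) between finite metric spaces and every r ≥ 0, if x and x' lie in the same block of θ_X^H(r) then f(x) and f(x') lie in the same block of θ_Y^H(r); (II) for every δ > 0, in H(Δ_2(δ)) the two points lie in different blocks of θ(t) for t < δ and in the same block for t ≥ δ; (III) for every finite metric space X with at least two points and every t < sep(X), θ_X^H(t) is the partition into singletons. Then H is the Vietoris–Rips (single linkage) hierarchical scheme: for every finite metric space (X,d) and every r ≥ 0, the blocks of θ_X^H(r) are exactly the equivalence classes of ∼_r. -/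
/-- The chain equivalence relation `∼_r` on a metric space. -/
def Sim {X : Type*} [PseudoMetricSpace X] (r : ℝ) : X → X → Prop :=
  Relation.ReflTransGen fun a b => dist a b ≤ r

/-- The separation of a metric space: the infimum of distances between distinct points. -/
noncomputable def sep (X : Type*) [MetricSpace X] : ℝ :=
  sInf {r | ∃ x x' : X, x ≠ x' ∧ dist x x' = r}

/-- In a finite metric space, the points outside a `∼_r` class stay a definite amount more
than `r` away from it. -/
theorem exists_gap_of_not_sim {X : Type*} [PseudoMetricSpace X] [Finite X] {r : ℝ} {x x' : X}
    (h : ¬ Sim r x x') :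
    ∃ δ > r, ∀ a b : X, Sim r x a → ¬ Sim r x b → δ ≤ dist a b := by
  let S := {p : X × X // Sim r x p.1 ∧ ¬ Sim r x p.2}
  have : Nonempty S := ⟨⟨(x, x'), .refl, h⟩⟩
  obtain ⟨⟨⟨a, b⟩, ha, hb⟩, hmin⟩ := Finite.exists_min fun p : S => dist p.1.1 p.1.2
  refine ⟨dist a b, ?_, fun c d hc hd => hmin ⟨(c, d), hc, hd⟩⟩
  by_contra hle
  exact hb (ha.tail (not_lt.mp hle))

/-- Uniqueness of single linkage (Vietoris–Rips) hierarchical clustering.  Let `H` assign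
to every finite metric space `X` a persistent set `θ_X^H` on `X` (a family of equivalence
relations indexed by `r ∈ [0,∞)` which is monotone and locally constant to the right),
functorially with respect to all distance non-increasing maps, such that (II) on the
two-point space `Δ_2(δ)` (`δ > 0`) the two points are related at time `t` iff `δ ≤ t`, and
(III) for `t < sep(X)` the relation at time `t` is trivial (singleton blocks).  Then `H`
is the Vietoris–Rips hierarchical scheme: the blocks of `θ_X^H(r)` are exactly the
equivalence classes of `∼_r`. -/
theorem stmt_17
    (H : ∀ (X : Type) [MetricSpace X] [Finite X], ℝ → X → X → Prop)
    (hEq : ∀ (X : Type) [MetricSpace X] [Finite X] (r : ℝ), 0 ≤ r → Equivalence (H X r))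
    (hMono : ∀ (X : Type) [MetricSpace X] [Finite X] (r s : ℝ), 0 ≤ r → r ≤ s →
      ∀ x x' : X, H X r x x' → H X s x x')
    (hRight : ∀ (X : Type) [MetricSpace X] [Finite X] (r : ℝ), 0 ≤ r →
      ∃ ε > (0 : ℝ), ∀ r' : ℝ, r ≤ r' → r' ≤ r + ε →
        ∀ x x' : X, (H X r' x x' ↔ H X r x x'))
    (hFun : ∀ (X : Type) [MetricSpace X] [Finite X] (Y : Type) [MetricSpace Y] [Finite Y]
      (f : X → Y), (∀ a b : X, dist (f a) (f b) ≤ dist a b) →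
      ∀ r : ℝ, 0 ≤ r → ∀ x x' : X, H X r x x' → H Y r (f x) (f x'))
    (hII : ∀ δ : ℝ, 0 < δ →
      ∀ (D : Type) [MetricSpace D] [Finite D] (p q : D),
        (∀ z : D, z = p ∨ z = q) → dist p q = δ →
        ∀ t : ℝ, 0 ≤ t → (H D t p q ↔ δ ≤ t))
    (hIII : ∀ (X : Type) [MetricSpace X] [Finite X], Nontrivial X →
      ∀ t : ℝ, 0 ≤ t → t < sep X → ∀ x x' : X, H X t x x' → x = x')
    (X : Type) [MetricSpace X] [Finite X] (r : ℝ) (hr : 0 ≤ r) (x x' : X) :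
    H X r x x' ↔ Sim r x x' := by
  constructor
  · intro h
    by_contra hs
    obtain ⟨δ, hδ, hgap⟩ := exists_gap_of_not_sim hs
    have hδ0 : 0 < δ := hr.trans_lt hδ
    classical
    let D : Type := ({0, δ} : Set ℝ)
    let p : D := ⟨0, by simp⟩
    let q : D := ⟨δ, by simp⟩
    have hpq : dist p q = δ := by
      change dist (0 : ℝ) δ = δ
      simp [abs_of_pos hδ0]
    have hD : ∀ z : D, z = p ∨ z = q := fun ⟨z, hz⟩ =>
      hz.imp (fun e => Subtype.ext e) fun e => Subtype.ext e
    let f : X → D := fun y => if Sim r x y then p else q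
    have hf : ∀ a b : X, dist (f a) (f b) ≤ dist a b := by
      intro a b
      by_cases ha : Sim r x a <;> by_cases hb : Sim r x b
      · simp [f, ha, hb]
      · simpa [f, ha, hb, hpq] using hgap a b ha hb
      · simpa [f, ha, hb, dist_comm q p, hpq, dist_comm a b] using hgap b a hb ha
      · simp [f, ha, hb]
    have hH := hFun X D f hf r hr x x' h
    have hfx : f x = p := if_pos .refl
    have hfx' : f x' = q := if_neg hs
    rw [hfx, hfx', hII δ hδ0 D p q hD hpq r hr] at hH
    exact hδ.not_ge hH
  · intro h
    induction h with
    | refl => exact (hEq X r hr).refl x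
    | @tail a b _ hab ih =>
      refine (hEq X r hr).trans ih ?_
      rcases eq_or_ne a b with rfl | hne
      · exact (hEq X r hr).refl a
      · let D : Type := ({a, b} : Set X)
        have hH : H D r ⟨a, by simp⟩ ⟨b, by simp⟩ :=
          (hII (dist a b) (dist_pos.mpr hne) D ⟨a, by simp⟩ ⟨b, by simp⟩
            (fun ⟨z, hz⟩ => hz.imp (fun e => Subtype.ext e) fun e => Subtype.ext e)
            rfl r hr).mpr hab
        exact hFun D X Subtype.val (fun _ _ => le_rfl) r hr _ _ hH
end

section
/- Fix r ≥ 0 and a positive integer m. For a finite metric space (X,d), define the equivalence relation ∼_r^m on X by: x ∼_r^m x' iff x = x', or (x ∼_r x' and the ∼_r-equivalence class [x]_r has cardinality at least m). Then ∼_r^m is functorial on injective distance non-increasing maps: for every injective distance non-increasing map f : (X,d_X) → (Y,d_Y) between finite metric spaces, x ∼_r^m x' in X implies f(x) ∼_r^m f(x') in Y. In particular, if |[x]_r| ≥ m in X then |[f(x)]_r| ≥ m in Y. -/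
/-- The relation `∼_r^m`: `x ∼_r^m x'` iff `x = x'`, or `x ∼_r x'` and the
`∼_r`-equivalence class of `x` has cardinality at least `m`. -/
def SimM {X : Type*} [PseudoMetricSpace X] (r : ℝ) (m : ℕ) (x x' : X) : Prop :=
  x = x' ∨ (Sim r x x' ∧ m ≤ Set.ncard {a : X | Sim r x a})

theorem Sim.map {X Y : Type*} [PseudoMetricSpace X] [PseudoMetricSpace Y] {r : ℝ} {f : X → Y}
    (hf : ∀ a b : X, dist (f a) (f b) ≤ dist a b) {x x' : X} (h : Sim r x x') :
    Sim r (f x) (f x') :=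
  Relation.ReflTransGen.lift f (fun a b hab => (hf a b).trans hab) _ _ h

theorem Sim.ncard_le_ncard_map {X Y : Type*} [PseudoMetricSpace X] [PseudoMetricSpace Y] [Finite Y]
    {r : ℝ} {f : X → Y} (hfi : Function.Injective f)
    (hf : ∀ a b : X, dist (f a) (f b) ≤ dist a b) (x : X) :
    Set.ncard {a : X | Sim r x a} ≤ Set.ncard {b : Y | Sim r (f x) b} :=
  Set.ncard_le_ncard_of_injOn f (fun _ ha => Sim.map hf ha) hfi.injOn (Set.toFinite _)

/-- The relation `∼_r^m` is functorial on injective distance non-increasing maps between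
finite metric spaces: `x ∼_r^m x'` in `X` implies `f(x) ∼_r^m f(x')` in `Y`.  In
particular, if `|[x]_r| ≥ m` in `X` then `|[f(x)]_r| ≥ m` in `Y`. -/
theorem stmt_19 (r : ℝ) (hr : 0 ≤ r) (m : ℕ) (hm : 0 < m)
    (X Y : Type) [MetricSpace X] [Finite X] [MetricSpace Y] [Finite Y]
    (f : X → Y) (hfi : Function.Injective f)
    (hf : ∀ a b : X, dist (f a) (f b) ≤ dist a b) :
    (∀ x x' : X, SimM r m x x' → SimM r m (f x) (f x')) ∧
    (∀ x : X, m ≤ Set.ncard {a : X | Sim r x a} →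
      m ≤ Set.ncard {b : Y | Sim r (f x) b}) := by
  refine ⟨?_, fun x h => h.trans (Sim.ncard_le_ncard_map hfi hf x)⟩
  rintro x x' (rfl | ⟨h, hc⟩)
  · exact Or.inl rfl
  · exact Or.inr ⟨h.map hf, hc.trans (Sim.ncard_le_ncard_map hfi hf x)⟩
end
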